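/- For every natural number n and every integer k with 1 ≤ k ≤ n+1, the coefficient of X^k in A_n(X) equals (1/(n+1))·binom(n+1, k)·(2i)^{n+1−k}·B_{n+1−k}(1/2), where binom denotes the binomial coefficient; moreover the constant coefficient of A_n is 0. -/

import Mathlib

open Polynomial Finset

/-- The pair of polynomial sequences (Aₙ, Cₙ) from the paper:
A₀ = X, C₀ = 0, and
A_{n+1} = ((n+1)/(n+2))·(X·Aₙ + ∑_{k=0}^{n} λₙᵏ·A_k),
C_{n+1} = ((n+1)/(n+2))·((X²+1)·Xⁿ + ∑_{k=0}^{n} λₙᵏ·C_k),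
where λₙᵏ is the coefficient of Xᵏ in Cₙ. -/
noncomputable def AC : ℕ → Polynomial ℂ × Polynomial ℂ
  | 0 => (Polynomial.X, 0)
  | (n+1) =>
    (((n+1 : ℂ)/(n+2)) • (Polynomial.X * (AC n).1 +
        ∑ k ∈ (Finset.range (n+1)).attach, ((AC n).2.coeff k) • (AC k).1),
     ((n+1 : ℂ)/(n+2)) • ((Polynomial.X^2 + 1) * Polynomial.X^n +
        ∑ k ∈ (Finset.range (n+1)).attach, ((AC n).2.coeff k) • (AC k).2))
  decreasing_by
  all_goals first
    | exact Nat.lt_succ_self n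
    | exact Nat.lt_succ_of_lt (Finset.mem_range.mp k.2)
    | exact Finset.mem_range.mp k.2

noncomputable def polyA (n : ℕ) : Polynomial ℂ := (AC n).1
noncomputable def polyC (n : ℕ) : Polynomial ℂ := (AC n).2

lemma polyA_zero : polyA 0 = X := by simp [polyA, AC]
lemma polyC_zero : polyC 0 = 0 := by simp [polyC, AC]

lemma polyA_succ (n : ℕ) : polyA (n+1) = ((n+1 : ℂ)/(n+2)) • (X * polyA n +
    ∑ k ∈ range (n+1), ((polyC n).coeff k) • polyA k) := by
  rw [polyA, AC, ← Finset.sum_attach (range (n+1))]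
  rfl

lemma polyC_succ (n : ℕ) : polyC (n+1) = ((n+1 : ℂ)/(n+2)) • ((X^2+1) * X^n +
    ∑ k ∈ range (n+1), ((polyC n).coeff k) • polyC k) := by
  rw [polyC, AC, ← Finset.sum_attach (range (n+1))]
  rfl

lemma polyA_coeff_zero (n : ℕ) : (polyA n).coeff 0 = 0 := by
  induction n using Nat.strong_induction_on with
  | _ n ih =>
    cases n with
    | zero => simp [polyA_zero]
    | succ n =>
      rw [polyA_succ, coeff_smul, coeff_add, finsetSum_coeff, Finset.sum_eq_zero]
      · simp
      · intro k hk
        rw [coeff_smul, ih k (by simpa using hk), smul_zero]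

lemma polyC_natDegree (n : ℕ) : (polyC n).natDegree ≤ n + 1 := by
  induction n using Nat.strong_induction_on with
  | _ n ih =>
    cases n with
    | zero => simp [polyC_zero]
    | succ n =>
      rw [polyC_succ]
      refine (natDegree_smul_le _ _).trans (natDegree_add_le_of_degree_le ?_ ?_)
      · compute_degree!
        omega
      · refine natDegree_sum_le_of_forall_le _ _ fun k hk => ?_
        have hk' : k < n + 1 := by simpa using hk
        exact (natDegree_smul_le _ _).trans ((ih k hk').trans (by omega))

lemma polyC_coeff_top (n : ℕ) : (polyC n).coeff (n+1) = (n : ℂ)/(n+1) := by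
  cases n with
  | zero => simp [polyC_zero]
  | succ n =>
    rw [polyC_succ, coeff_smul, coeff_add, finsetSum_coeff, Finset.sum_eq_zero]
    · rw [add_mul, ← pow_add, coeff_add, one_mul, coeff_X_pow, coeff_X_pow,
        if_pos (by omega), if_neg (by omega)]
      push_cast
      simp [add_assoc]
      norm_num
    · intro k hk
      have hk' : k < n + 1 := by simpa using hk
      rw [coeff_smul, coeff_eq_zero_of_natDegree_lt (p := polyC k), smul_zero]
      exact (polyC_natDegree k).trans_lt (by omega)

lemma polyC_trunc (n : ℕ) (x : ℂ) : ∑ k ∈ range (n+1), (polyC n).coeff k * x ^ k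
    = (polyC n).eval x - (n : ℂ)/(n+1) * x^(n+1) := by
  rw [eval_eq_sum_range' (n := n+2) (Nat.lt_succ_of_le (polyC_natDegree n)),
    Finset.sum_range_succ _ (n+1), polyC_coeff_top]
  ring

lemma main_ind (n : ℕ) : (∀ x : ℂ, (polyA n).eval (x + Complex.I) - (polyA n).eval (x - Complex.I)
      = 2 * Complex.I * x ^ n) ∧
    (∀ x : ℂ, (polyC n).eval x = x^(n+1) -
      ((polyA n).eval (x + Complex.I) + (polyA n).eval (x - Complex.I)) / 2) := by
  induction n using Nat.strong_induction_on with
  | _ n ih =>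
    cases n with
    | zero => 
      constructor
      · intro x; simp [polyA_zero]; ring
      · intro x; simp [polyA_zero, polyC_zero]
    | succ n =>
      have hI : Complex.I ^ 2 = -1 := Complex.I_sq
      have h1 : (n : ℂ) + 1 ≠ 0 := by exact_mod_cast Nat.succ_ne_zero n
      have h2 : (n : ℂ) + 2 ≠ 0 := by exact_mod_cast Nat.succ_ne_zero (n+1)
      have eA : ∀ y, (polyA (n+1)).eval y = ((n+1 : ℂ)/(n+2)) * (y * (polyA n).eval y +
          ∑ k ∈ range (n+1), (polyC n).coeff k * (polyA k).eval y) := by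
        intro y; rw [polyA_succ]; simp [eval_finsetSum, mul_add]
      have eC : ∀ y, (polyC (n+1)).eval y = ((n+1 : ℂ)/(n+2)) * ((y^2+1)*y^n +
          ∑ k ∈ range (n+1), (polyC n).coeff k * (polyC k).eval y) := by
        intro y; rw [polyC_succ]; simp [eval_finsetSum, mul_add]
      obtain ⟨hA, hC⟩ := ih n (Nat.lt_succ_self n)
      have sA : ∀ x, ∑ k ∈ range (n+1), (polyC n).coeff k * (polyA k).eval (x + Complex.I)
          - ∑ k ∈ range (n+1), (polyC n).coeff k * (polyA k).eval (x - Complex.I)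
          = 2 * Complex.I * ((polyC n).eval x - (n : ℂ)/(n+1) * x^(n+1)) := by
        intro x
        rw [← polyC_trunc, ← Finset.sum_sub_distrib, Finset.mul_sum]
        refine Finset.sum_congr rfl fun k hk => ?_
        have := (ih k (by simpa using hk)).1 x
        linear_combination (polyC n).coeff k * this
      have sC : ∀ x, ∑ k ∈ range (n+1), (polyC n).coeff k * (polyC k).eval x
          = x * ((polyC n).eval x - (n : ℂ)/(n+1) * x^(n+1))
          - (∑ k ∈ range (n+1), (polyC n).coeff k * (polyA k).eval (x + Complex.I)
          + ∑ k ∈ range (n+1), (polyC n).coeff k * (polyA k).eval (x - Complex.I)) / 2 := by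
        intro x
        rw [← polyC_trunc, ← Finset.sum_add_distrib, Finset.mul_sum, Finset.sum_div,
          ← Finset.sum_sub_distrib]
        refine Finset.sum_congr rfl fun k hk => ?_
        rw [(ih k (by simpa using hk)).2 x]
        ring
      have hn : ((n+1 : ℂ)/(n+2)) * (2 - (n : ℂ)/(n+1)) = 1 := by field_simp; ring
      constructor
      · intro x
        have a := sA x
        have b := hA x
        have c := hC x
        rw [eA, eA]
        linear_combination ((n+1 : ℂ)/(n+2)) * (a + x * b + 2 * Complex.I * c)
          + 2 * Complex.I * x^(n+1) * hn
      · intro x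
        have a := sC x
        have b := hA x
        have c := hC x
        rw [eA, eA, eC]
        linear_combination ((n+1 : ℂ)/(n+2)) * (a + x * c + Complex.I/2 * b + x^n * hI)
          + x^(n+2) * hn

lemma hasse_bernoulli (n k : ℕ) : hasseDeriv k (Polynomial.bernoulli n)
    = (n.choose k : ℚ) • Polynomial.bernoulli (n - k) := by
  ext j
  rw [hasseDeriv_coeff, coeff_smul, coeff_bernoulli, coeff_bernoulli]
  by_cases h : j + k ≤ n
  · rw [if_pos h, if_pos (by omega)]
    have h3 := Nat.choose_mul (n := n) (k := j+k) (s := k) (by omega)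
    rw [Nat.add_sub_cancel] at h3
    have h4 : ((n.choose (j+k) : ℚ) * ((j+k).choose k)) = n.choose k * (n-k).choose j := by
      exact_mod_cast h3
    rw [show n - (j+k) = n - k - j by omega, smul_eq_mul]
    linear_combination _root_.bernoulli (n-k-j) * h4
  · rw [if_neg h]
    by_cases hk : k ≤ n
    · rw [if_neg (by omega)]; simp
    · rw [Nat.choose_eq_zero_of_lt (show n < k by omega)]; simp

noncomputable def bC (n : ℕ) : ℂ[X] := (Polynomial.bernoulli n).map (algebraMap ℚ ℂ)

lemma bC_eval_one_add (n : ℕ) (x : ℂ) : (bC n).eval (1 + x) = (bC n).eval x + n * x^(n-1) := by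
  have h := congrArg (fun p => (p.map (algebraMap ℚ ℂ)).eval x) (bernoulli_comp_one_add_X n)
  simpa [bC, Polynomial.map_comp] using h

noncomputable def pE (n : ℕ) : ℂ[X] := C ((2*Complex.I)^(n+1)/(n+1)) *
  ((taylor (1/2) (bC (n+1))).comp (C (1/(2*Complex.I)) * X) - C ((bC (n+1)).eval (1/2)))

lemma pE_eval (n : ℕ) (x : ℂ) : (pE n).eval x = (2*Complex.I)^(n+1)/(n+1) *
    ((bC (n+1)).eval (x/(2*Complex.I) + 1/2) - (bC (n+1)).eval (1/2)) := by
  simp only [pE, eval_mul, eval_C, eval_sub, eval_comp, eval_X, taylor_eval]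
  ring_nf

lemma pE_diff (n : ℕ) (x : ℂ) : (pE n).eval (x + Complex.I) - (pE n).eval (x - Complex.I)
      = 2 * Complex.I * x ^ n := by
  have hI := Complex.I_ne_zero
  have h1 : (n : ℂ) + 1 ≠ 0 := by exact_mod_cast Nat.succ_ne_zero n
  rw [pE_eval, pE_eval,
    show (x + Complex.I)/(2*Complex.I) + 1/2 = 1 + x/(2*Complex.I) by field_simp; ring,
    show (x - Complex.I)/(2*Complex.I) + 1/2 = x/(2*Complex.I) by field_simp; ring,
    bC_eval_one_add, Nat.add_sub_cancel, div_pow, pow_succ]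
  push_cast
  field_simp
  ring

lemma polyA_eq (n : ℕ) : polyA n = pE n := by
  have hz : ∀ m : ℕ, (polyA n).eval (2 * Complex.I * m) = (pE n).eval (2 * Complex.I * m) := by
    intro m
    induction m with
    | zero =>
      have := polyA_coeff_zero n
      rw [coeff_zero_eq_eval_zero] at this
      simp [this, pE_eval]
    | succ m ih =>
      have a := (main_ind n).1 (2 * Complex.I * m + Complex.I)
      have b := pE_diff n (2 * Complex.I * m + Complex.I)
      rw [add_sub_cancel_right, show 2 * Complex.I * m + Complex.I + Complex.I
        = 2 * Complex.I * ((m+1 : ℕ) : ℂ) by push_cast; ring] at a b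
      linear_combination a - b + ih
  refine eq_of_infinite_eval_eq _ _ (Set.Infinite.mono (s := Set.range fun m : ℕ =>
    2 * Complex.I * (m : ℂ)) ?_ (Set.infinite_range_of_injective ?_))
  · rintro _ ⟨m, rfl⟩
    exact hz m
  · intro a b h
    have h' := mul_left_cancel₀ (by simp [Complex.I_ne_zero]) h
    exact_mod_cast h'

lemma taylor_bC_coeff (n k : ℕ) (r : ℂ) : (taylor r (bC n)).coeff k
    = n.choose k * (bC (n-k)).eval r := by
  have h : hasseDeriv k (bC n) = C (n.choose k : ℂ) * bC (n-k) := by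
    have h := congrArg (Polynomial.map (algebraMap ℚ ℂ)) (hasse_bernoulli n k)
    ext j
    have hj := congrArg (fun p => p.coeff j) h
    simpa [bC, hasseDeriv_coeff] using hj
  rw [taylor_coeff, h]
  simp

theorem stmt10 (n : ℕ) :
    (∀ k : ℕ, 1 ≤ k → k ≤ n + 1 →
      (polyA n).coeff k =
        (1 / (n + 1 : ℂ)) * ((n + 1).choose k : ℂ) * (2 * Complex.I) ^ (n + 1 - k) *
          Polynomial.aeval ((1 : ℂ) / 2) (Polynomial.bernoulli (n + 1 - k))) ∧
    (polyA n).coeff 0 = 0 := by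
  refine ⟨fun k hk hkn => ?_, polyA_coeff_zero n⟩
  have hI : 2 * Complex.I ≠ 0 := by simp [Complex.I_ne_zero]
  rw [polyA_eq, pE, coeff_C_mul, coeff_sub, comp_C_mul_X_coeff, taylor_bC_coeff,
    coeff_C_of_ne_zero (by omega), sub_zero, aeval_def, ← eval_map, ← bC]
  obtain ⟨m, hm⟩ := Nat.exists_eq_add_of_le hkn
  rw [show n + 1 - k = m by omega, show (2*Complex.I)^(n+1) = (2*Complex.I)^k*(2*Complex.I)^m by
    rw [hm, pow_add], one_div_pow]
  field_simp
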